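/- arXiv:2502.00311 — 2 statements merged into one kernel-verified Lean document; each statement's English description precedes it below -/
import Mathlib

section
/- Let d = c·m and s = c·s_c for positive integers c, m, s_c with s_c ≤ m, and let G be a random vector in ℝ^d whose entries are almost surely nonzero with pairwise distinct absolute values. Let G̃' be the chunk-based s-sparsification of G and G̃ = Sparsify_s(G) the global s-sparsification. Suppose that almost surely every index j in the symmetric difference supp(G̃) Δ supp(G̃') satisfies G_j² ≤ ‖G̃'‖₂²/s, and let G_max be an upper bound on E[‖G̃'‖₂²]. Then E[‖G̃' − G̃‖₂²] ≤ 2·(1 − s/d)·G_max. -/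
open Finset

/-- Support of a vector: the set of indices with nonzero entries. -/
noncomputable def supp {d : ℕ} (y : Fin d → ℝ) : Finset (Fin d) :=
  Finset.univ.filter (fun i => y i ≠ 0)

/-- `IsSparsify s x y` : `y` is obtained from `x` by keeping the `s` entries of
largest absolute value and setting all other entries to zero. -/
def IsSparsify {d : ℕ} (s : ℕ) (x y : Fin d → ℝ) : Prop :=
  ∃ S : Finset (Fin d), S.card = s ∧ (∀ i ∈ S, ∀ j ∉ S, |x j| < |x i|) ∧
    y = fun i => if i ∈ S then x i else 0

/-- `IsChunkSparsify c m sc x y` : partitioning `x : ℝ^(c*m)` into `c` consecutive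
chunks of size `m` (chunk of index `j` is `j / m`), `y` is obtained by keeping, within
each chunk, the `sc` entries of largest absolute value and zeroing the rest. -/
def IsChunkSparsify (c m sc : ℕ) (x y : Fin (c * m) → ℝ) : Prop :=
  ∃ S : Finset (Fin (c * m)),
    (∀ i < c, (S.filter (fun j : Fin (c * m) => (j : ℕ) / m = i)).card = sc) ∧
    (∀ j ∈ S, ∀ j' ∉ S, (j : ℕ) / m = (j' : ℕ) / m → |x j'| < |x j|) ∧
    y = fun j => if j ∈ S then x j else 0

open MeasureTheory

theorem card_filter_div_eq_le (c m : ℕ) (hm : 0 < m) (i : ℕ) (S : Finset (Fin (c * m))) :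
    (S.filter (fun j : Fin (c * m) => (j : ℕ) / m = i)).card ≤ m := by
  have h := Finset.card_le_card_of_injOn (s := S.filter (fun j : Fin (c * m) => (j : ℕ) / m = i))
    (t := Finset.range m) (fun j => (j : ℕ) % m)
    (fun j _ => by simpa using Nat.mod_lt _ hm) (by
      intro a ha b hb hab
      simp only [Finset.coe_filter, Set.mem_ofPred_eq] at ha hb hab
      apply Fin.ext
      rw [← Nat.div_add_mod (a : ℕ) m, ← Nat.div_add_mod (b : ℕ) m, ha.2, hb.2, hab])
  simpa using h

theorem card_eq_sum_card_filter_div (c m : ℕ) (S : Finset (Fin (c * m))) :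
    S.card = ∑ i ∈ Finset.range c, (S.filter (fun j : Fin (c * m) => (j : ℕ) / m = i)).card :=
  Finset.card_eq_sum_card_fiberwise fun j _ => by
    simpa only [Finset.coe_range, Set.mem_Iio] using
      Nat.div_lt_of_lt_mul (by simp [mul_comm m c])

/-- A global top set meets a chunkwise top set in at least a fraction `sc / m` of its elements. -/
theorem mul_card_le_mul_card_inter {c m sc : ℕ} (hm : 0 < m) (hscm : sc ≤ m)
    {x : Fin (c * m) → ℝ} {S T : Finset (Fin (c * m))}
    (hS : ∀ i ∈ S, ∀ j ∉ S, |x j| < |x i|)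
    (hTcard : ∀ i < c, (T.filter (fun j : Fin (c * m) => (j : ℕ) / m = i)).card = sc)
    (hT : ∀ j ∈ T, ∀ j' ∉ T, (j : ℕ) / m = (j' : ℕ) / m → |x j'| < |x j|) :
    sc * S.card ≤ m * (S ∩ T).card := by
  rw [card_eq_sum_card_filter_div c m S, card_eq_sum_card_filter_div c m (S ∩ T),
    Finset.mul_sum, Finset.mul_sum]
  refine Finset.sum_le_sum fun i hi => ?_
  by_cases hsub : ∀ j ∈ S, (j : ℕ) / m = i → j ∈ T
  · refine Nat.mul_le_mul hscm (Finset.card_le_card fun j hj => ?_)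
    rw [Finset.mem_filter] at hj
    exact Finset.mem_filter.2 ⟨Finset.mem_inter.2 ⟨hj.1, hsub j hj.1 hj.2⟩, hj.2⟩
  · push Not at hsub
    obtain ⟨j, hjS, hji, hjT⟩ := hsub
    have hle : sc ≤ ((S ∩ T).filter (fun j : Fin (c * m) => (j : ℕ) / m = i)).card := by
      rw [← hTcard i (Finset.mem_range.1 hi)]
      refine Finset.card_le_card fun k hk => ?_
      rw [Finset.mem_filter] at hk
      refine Finset.mem_filter.2 ⟨Finset.mem_inter.2 ⟨?_, hk.1⟩, hk.2⟩
      by_contra hkS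
      exact lt_asymm (hS j hjS k hkS) (hT k hk.1 j hjT (hk.2.trans hji.symm))
    calc _ ≤ sc * m := Nat.mul_le_mul_left _ (card_filter_div_eq_le c m hm i S)
      _ = m * sc := mul_comm _ _
      _ ≤ _ := Nat.mul_le_mul_left _ hle

theorem supp_ite_mem {d : ℕ} {x : Fin d → ℝ} (hx : ∀ j, x j ≠ 0) (S : Finset (Fin d)) :
    supp (fun i => if i ∈ S then x i else 0) = S := by
  ext i
  simp [supp, hx i]

theorem sum_sq_ite_sub_ite {d : ℕ} (x : Fin d → ℝ) (S T : Finset (Fin d)) :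
    ∑ j, ((if j ∈ T then x j else 0) - (if j ∈ S then x j else 0)) ^ 2 =
      ∑ j ∈ symmDiff S T, x j ^ 2 := by
  rw [← Finset.sum_filter_add_sum_filter_not Finset.univ (· ∈ symmDiff S T)]
  rw [Finset.sum_eq_zero (s := Finset.univ.filter (¬ · ∈ symmDiff S T)), add_zero,
    Finset.filter_univ_mem]
  · refine Finset.sum_congr rfl fun j hj => ?_
    rcases Finset.mem_symmDiff.1 hj with ⟨h1, h2⟩ | ⟨h1, h2⟩ <;> simp [h1, h2]
  · intro j hj
    have hj' := (Finset.mem_filter.1 hj).2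
    rw [Finset.mem_symmDiff] at hj'
    by_cases h1 : j ∈ S <;> by_cases h2 : j ∈ T <;> simp_all

theorem card_symmDiff_add_two_mul_card_inter {α : Type*} [DecidableEq α] (S T : Finset α) :
    (symmDiff S T).card + 2 * (S ∩ T).card = S.card + T.card := by
  have h1 := Finset.card_sdiff_add_card_inter S T
  have h2 := Finset.card_sdiff_add_card_inter T S
  have h3 : (symmDiff S T).card = (S \ T).card + (T \ S).card :=
    Finset.card_union_of_disjoint disjoint_sdiff_sdiff
  rw [Finset.inter_comm T S] at h2
  omega

/-- The deterministic form of the comparison of the two sparsifications. -/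
theorem sum_sq_sub_le_of_isSparsify {c m sc : ℕ} (hc : 0 < c) (hm : 0 < m) (hsc : 0 < sc)
    (hscm : sc ≤ m) {x y y' : Fin (c * m) → ℝ} (hx : ∀ j, x j ≠ 0)
    (hy : IsSparsify (c * sc) x y) (hy' : IsChunkSparsify c m sc x y')
    (hbound : ∀ j ∈ symmDiff (supp y) (supp y'), x j ^ 2 ≤ (∑ i, y' i ^ 2) / (c * sc)) :
    ∑ j, (y' j - y j) ^ 2 ≤ 2 * (1 - (c * sc : ℝ) / (c * m)) * ∑ i, y' i ^ 2 := by
  obtain ⟨S, hScard, hS, rfl⟩ := hy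
  obtain ⟨T, hTcard, hT, hyT⟩ := hy'
  have hsupp : supp y' = T := hyT ▸ supp_ite_mem hx T
  rw [supp_ite_mem hx, hsupp] at hbound
  have hN : 0 ≤ ∑ i, y' i ^ 2 := Finset.sum_nonneg fun i _ => sq_nonneg _
  set N := ∑ i, y' i ^ 2
  have hTc : T.card = c * sc := by
    rw [card_eq_sum_card_filter_div c m T,
      Finset.sum_congr rfl fun i hi => hTcard i (Finset.mem_range.1 hi)]
    simp
  have hinter := mul_card_le_mul_card_inter hm hscm hS hTcard hT
  have hsymm := card_symmDiff_add_two_mul_card_inter S T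
  rw [hScard] at hinter
  rw [hScard, hTc] at hsymm
  have hinter' : (sc : ℝ) * (c * sc) ≤ m * (S ∩ T).card := by exact_mod_cast hinter
  have hsymm' : ((symmDiff S T).card : ℝ) + 2 * (S ∩ T).card = c * sc + c * sc := by
    exact_mod_cast hsymm
  have hc' : (0 : ℝ) < c := by exact_mod_cast hc
  have hm' : (0 : ℝ) < m := by exact_mod_cast hm
  have hsc' : (0 : ℝ) < sc := by exact_mod_cast hsc
  have hcard : ((symmDiff S T).card : ℝ) ≤ 2 * (1 - (c * sc : ℝ) / (c * m)) * (c * sc) := by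
    rw [mul_div_mul_left _ _ hc'.ne']
    have h : (sc : ℝ) * (c * sc) / m ≤ (S ∩ T).card := by
      rw [div_le_iff₀ hm']
      linarith
    have h' : 2 * (1 - (sc : ℝ) / m) * (c * sc) = 2 * (c * sc) - 2 * (sc * (c * sc) / m) := by
      ring
    linarith
  calc ∑ j, (y' j - if j ∈ S then x j else 0) ^ 2 = ∑ j ∈ symmDiff S T, x j ^ 2 := by
        rw [hyT, sum_sq_ite_sub_ite]
    _ ≤ (symmDiff S T).card * (N / (c * sc)) := by
        simpa using Finset.sum_le_card_nsmul _ _ _ hbound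
    _ ≤ 2 * (1 - (c * sc : ℝ) / (c * m)) * (c * sc) * (N / (c * sc)) := by gcongr
    _ = 2 * (1 - (c * sc : ℝ) / (c * m)) * N := by field_simp

theorem stmt1 {Ω : Type*} [MeasurableSpace Ω] (μ : Measure Ω) [IsProbabilityMeasure μ]
    (c m sc : ℕ) (hc : 0 < c) (hm : 0 < m) (hsc : 0 < sc) (hscm : sc ≤ m)
    (G Gt Gt' : Ω → Fin (c * m) → ℝ) (Gmax : ℝ)
    (hnz : ∀ᵐ ω ∂μ, ∀ j, G ω j ≠ 0)
    (hinj : ∀ᵐ ω ∂μ, Function.Injective (fun j => |G ω j|))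
    (hGt : ∀ᵐ ω ∂μ, IsSparsify (c * sc) (G ω) (Gt ω))
    (hGt' : ∀ᵐ ω ∂μ, IsChunkSparsify c m sc (G ω) (Gt' ω))
    (hbound : ∀ᵐ ω ∂μ, ∀ j ∈ symmDiff (supp (Gt ω)) (supp (Gt' ω)),
      (G ω j) ^ 2 ≤ (∑ i, (Gt' ω i) ^ 2) / (c * sc))
    (hmeas : AEStronglyMeasurable (fun ω => ∑ j, (Gt' ω j - Gt ω j) ^ 2) μ)
    (hint : Integrable (fun ω => ∑ i, (Gt' ω i) ^ 2) μ)
    (hGmax : ∫ ω, ∑ i, (Gt' ω i) ^ 2 ∂μ ≤ Gmax) :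
    ∫ ω, ∑ j, (Gt' ω j - Gt ω j) ^ 2 ∂μ ≤ 2 * (1 - (c * sc : ℝ) / (c * m)) * Gmax := by
  have hfactor : 0 ≤ 2 * (1 - (c * sc : ℝ) / (c * m)) := by
    have : (c * sc : ℝ) / (c * m) ≤ 1 := by
      apply div_le_one_of_le₀ _ (by positivity)
      gcongr
    linarith
  have hle : ∀ᵐ ω ∂μ, ∑ j, (Gt' ω j - Gt ω j) ^ 2 ≤
      2 * (1 - (c * sc : ℝ) / (c * m)) * ∑ i, (Gt' ω i) ^ 2 := by
    filter_upwards [hnz, hGt, hGt', hbound] with ω h1 h2 h3 h4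
    exact sum_sq_sub_le_of_isSparsify hc hm hsc hscm h1 h2 h3 h4
  calc ∫ ω, ∑ j, (Gt' ω j - Gt ω j) ^ 2 ∂μ
      ≤ ∫ ω, 2 * (1 - (c * sc : ℝ) / (c * m)) * ∑ i, (Gt' ω i) ^ 2 ∂μ :=
        integral_mono_of_nonneg
          (Filter.Eventually.of_forall fun ω => Finset.sum_nonneg fun j _ => sq_nonneg _)
          (hint.const_mul _) hle
    _ = 2 * (1 - (c * sc : ℝ) / (c * m)) * ∫ ω, ∑ i, (Gt' ω i) ^ 2 ∂μ := integral_const_mul _ _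
    _ ≤ 2 * (1 - (c * sc : ℝ) / (c * m)) * Gmax := by gcongr
end

section
/- Let d = c·m and s = c·s_c for positive integers c, m, s_c with s_c ≤ m, and let G ∈ ℝ^d have all entries nonzero with pairwise distinct absolute values. Let G̃ = Sparsify_s(G) and let G̃' be the chunk-based s-sparsification. For each chunk i, let t_i be the number of indices of supp(G̃) lying in chunk i. Then for every chunk i with t_i ≤ s_c, all indices of supp(G̃) lying in chunk i also belong to supp(G̃'); more generally, the indices of chunk i belonging to supp(G̃) have the t_i largest absolute values among the entries of chunk i of G. -/
open Finset

lemma supp_ite {d : ℕ} {x : Fin d → ℝ} (hx : ∀ j, x j ≠ 0) (S : Finset (Fin d)) :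
    supp (fun j => if j ∈ S then x j else 0) = S := by
  ext j
  simp [supp, hx j]

theorem stmt3 (c m sc : ℕ) (hc : 0 < c) (hm : 0 < m) (hsc : 0 < sc) (hscm : sc ≤ m)
    (G Gt Gt' : Fin (c * m) → ℝ)
    (hnz : ∀ j, G j ≠ 0)
    (hinj : Function.Injective (fun j => |G j|))
    (hGt : IsSparsify (c * sc) G Gt)
    (hGt' : IsChunkSparsify c m sc G Gt') :
    (∀ i < c, ((supp Gt).filter (fun j : Fin (c * m) => (j : ℕ) / m = i)).card ≤ sc →
      ∀ j ∈ supp Gt, (j : ℕ) / m = i → j ∈ supp Gt') ∧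
    (∀ j ∈ supp Gt, ∀ j' : Fin (c * m), (j' : ℕ) / m = (j : ℕ) / m → j' ∉ supp Gt → |G j'| < |G j|) := by
  obtain ⟨S, -, hS, rfl⟩ := hGt
  obtain ⟨S', hcard, hS', rfl⟩ := hGt'
  rw [supp_ite hnz, supp_ite hnz]
  refine ⟨fun i hi hle j hj hji => ?_, fun j hj j' _ hj' => hS j hj j' hj'⟩
  by_contra hjS'
  have hsub : insert j (S'.filter (fun k : Fin (c * m) => (k : ℕ) / m = i)) ⊆
      S.filter (fun k : Fin (c * m) => (k : ℕ) / m = i) := by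
    intro k hk
    rw [mem_insert, mem_filter] at hk
    rw [mem_filter]
    obtain rfl | ⟨hkS', hki⟩ := hk
    · exact ⟨hj, hji⟩
    · refine ⟨?_, hki⟩
      by_contra hkS
      exact lt_asymm (hS j hj k hkS) (hS' k hkS' j hjS' (hki.trans hji.symm))
  have hlt := card_le_card hsub
  rw [card_insert_of_notMem (fun h => hjS' (mem_filter.mp h).1), hcard i hi] at hlt
  omega
end
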